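/- Murnaghan–Nakayama rule for k-Schur functions: with the data below, for every 1 ≤ r ≤ k and every w ∈ S̃⁰_{k+1}, one has p^R_r s^{(k)}_w = Σ_{w' ∈ S̃⁰_{k+1}} ( Σ_{i=0}^{r−1} (−1)^i |V^{r,w'}_{i,c}| ) s^{(k)}_{w'}, where V^{r,w'}_{i,c} = {u ∈ V^r_{i,c} : u · w = w'} with · the dot action. -/

import Mathlib

open scoped BigOperators Classical

noncomputable section

namespace MN

/-! ## Residues, words, canonical cyclic intervals -/

/-- The residues `ℤ/(k+1)ℤ`. -/
abbrev Idx (k : ℕ) := ZMod (k + 1)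

/-- A word in the generators, recorded by its list of indices. -/
abbrev Word (k : ℕ) := List (Idx k)

/-- The support of a word. -/
def supp (k : ℕ) (u : Word k) : Finset (Idx k) := u.toFinset

/-- The smallest `a ∈ {0,…,k}` (as a natural number) with `(a : ℤ/(k+1)) ∉ S`. -/
def gapNat (k : ℕ) (S : Finset (Idx k)) : ℕ :=
  if h : ∃ m : ℕ, m ≤ k ∧ (m : Idx k) ∉ S then Nat.find h else 0

/-- The gap element `a` of a proper subset `S`. -/
def gap (k : ℕ) (S : Finset (Idx k)) : Idx k := (gapNat k S : Idx k)

/-- Position of a residue `i` in the canonical cyclic interval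
`I_S : a+1 < a+2 < ⋯ < k < 0 < ⋯ < a−1` (the gap `a` itself gets the junk position `k`). -/
def pos (k : ℕ) (S : Finset (Idx k)) (i : Idx k) : ℕ := (i - gap k S - 1).val

/-- The list of positions of the letters of `u` in the canonical cyclic interval of its support. -/
def posList (k : ℕ) (u : Word k) : List ℕ := u.map (pos k (supp k u))

/-- A weak hook word of hook type V:
`i₁ > ⋯ > i_j < i_{j+1} < ⋯ < i_m` with respect to `I_{supp u}`. -/
def IsHookV (k : ℕ) (u : Word k) : Prop :=
  supp k u ≠ Finset.univ ∧
    ∃ (ds as : List ℕ) (v : ℕ),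
      posList k u = ds ++ v :: as ∧
        List.Chain' (· > ·) (ds ++ [v]) ∧ List.Chain' (· < ·) (v :: as)

/-- A weak hook word of hook type U:
`i₁ > ⋯ > i_j = i_{j+1} < ⋯ < i_m` with respect to `I_{supp u}`. -/
def IsHookU (k : ℕ) (u : Word k) : Prop :=
  supp k u ≠ Finset.univ ∧
    ∃ (ds as : List ℕ) (v : ℕ),
      posList k u = ds ++ v :: v :: as ∧
        List.Chain' (· > ·) (ds ++ [v]) ∧ List.Chain' (· < ·) (v :: as)

/-- A weak hook word. -/
def IsWeakHook (k : ℕ) (u : Word k) : Prop := IsHookV k u ∨ IsHookU k u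

/-- The number of ascents `i_t < i_{t+1}` of a word. -/
def asc (k : ℕ) (u : Word k) : ℕ :=
  ((posList k u).zip (posList k u).tail).countP fun p => decide (p.1 < p.2)

/-- The candidates `c` in the definition of `u_min`: letters `c` of `u` for which there is a
letter `a` of `u` with `a < c` in `I_{supp u}`, `a + 1 ≠ c`, and no letter `b` of `u` satisfies
`a < b < c`. -/
def uminCands (k : ℕ) (u : Word k) : Finset (Idx k) :=
  (supp k u).filter fun c =>
    ∃ a ∈ supp k u,
      pos k (supp k u) a < pos k (supp k u) c ∧ a + 1 ≠ c ∧
        ∀ b ∈ supp k u,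
          ¬(pos k (supp k u) a < pos k (supp k u) b ∧
            pos k (supp k u) b < pos k (supp k u) c)

/-- The letter `u_min` of `u` (junk value `0` if there is no candidate). -/
def umin (k : ℕ) (u : Word k) : Idx k :=
  if h : (uminCands k u).Nonempty then
    ((uminCands k u).exists_min_image (pos k (supp k u)) h).choose
  else 0

/-- The number of occurrences of `u_min` in `u` (`0` if there is no candidate). -/
def uminCount (k : ℕ) (u : Word k) : ℕ :=
  if (uminCands k u).Nonempty then u.count (umin k u) else 0

/-- A set of residues is `k`-connected if it is a proper subset of `{0,…,k}` which is an
interval with respect to its canonical cyclic interval order. -/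
def IsKConnectedSet (k : ℕ) (S : Finset (Idx k)) : Prop :=
  S ≠ Finset.univ ∧
    ∀ i ∈ S, ∀ j ∈ S, ∀ m : Idx k,
      pos k S i ≤ pos k S m → pos k S m ≤ pos k S j → m ∈ S

/-- A word is `k`-connected if its support is. -/
def IsKConnected (k : ℕ) (u : Word k) : Prop := IsKConnectedSet k (supp k u)

/-- A word is `k`-weak connected if `u_min` occurs `0` or `2` times in it. -/
def IsWeakConnected (k : ℕ) (u : Word k) : Prop :=
  uminCount k u = 0 ∨ uminCount k u = 2

/-- The letter `c` lies on the left side (the maximal strictly decreasing initial segment) of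
the hook form of `u`: equivalently, it occurs in some strictly decreasing initial segment. -/
def OnLeftSide (k : ℕ) (u : Word k) (c : Idx k) : Prop :=
  ∃ p q : Word k, u = p ++ q ∧
    List.Chain' (fun a b => pos k (supp k u) b < pos k (supp k u) a) p ∧ c ∈ p

/-- The letter `c` lies on the right side (the maximal strictly increasing final segment) of
the hook form of `u`. -/
def OnRightSide (k : ℕ) (u : Word k) (c : Idx k) : Prop :=
  ∃ p q : Word k, u = p ++ q ∧
    List.Chain' (fun a b => pos k (supp k u) a < pos k (supp k u) b) q ∧ c ∈ q

/-! ## The sets `X^r_i` and their refinements (indexed by `i : ℤ`, empty for `i < 0`) -/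

/-- `V^r_i`: weak hook words of hook type V, weak length `r`, `asc = i`. -/
def VSet (k r : ℕ) (i : ℤ) : Set (Word k) :=
  {u | IsHookV k u ∧ u.length = r ∧ (asc k u : ℤ) = i}

/-- `U^r_i`. -/
def USet (k r : ℕ) (i : ℤ) : Set (Word k) :=
  {u | IsHookU k u ∧ u.length = r ∧ (asc k u : ℤ) = i}

/-- `V^r_{i,wc}`: the `k`-weak connected members of `V^r_i`. -/
def VSetWC (k r : ℕ) (i : ℤ) : Set (Word k) := {u ∈ VSet k r i | IsWeakConnected k u}

/-- `U^r_{i,wc}`. -/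
def USetWC (k r : ℕ) (i : ℤ) : Set (Word k) := {u ∈ USet k r i | IsWeakConnected k u}

/-- `V^r_{i,c}`: the `k`-connected members of `V^r_i`. -/
def VSetC (k r : ℕ) (i : ℤ) : Set (Word k) := {u ∈ VSet k r i | IsKConnected k u}

/-- `V^r_{i,w̄c,left}`. -/
def VSetNWCL (k r : ℕ) (i : ℤ) : Set (Word k) :=
  {u ∈ VSet k r i | ¬IsWeakConnected k u ∧ OnLeftSide k u (umin k u)}

/-- `V^r_{i,w̄c,right}`. -/
def VSetNWCR (k r : ℕ) (i : ℤ) : Set (Word k) :=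
  {u ∈ VSet k r i | ¬IsWeakConnected k u ∧ OnRightSide k u (umin k u)}

/-- `U^r_{i,w̄c,left}`. -/
def USetNWCL (k r : ℕ) (i : ℤ) : Set (Word k) :=
  {u ∈ USet k r i | ¬IsWeakConnected k u ∧ OnLeftSide k u (umin k u)}

/-- `U^r_{i,w̄c,right}`. -/
def USetNWCR (k r : ℕ) (i : ℤ) : Set (Word k) :=
  {u ∈ USet k r i | ¬IsWeakConnected k u ∧ OnRightSide k u (umin k u)}

/-! ## The algebras `𝒜_k`, `ℋ_k`, `𝒩_k` -/

/-- The defining relations of `𝒜_k`. -/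
inductive AkRel (k : ℕ) : FreeAlgebra ℤ (Idx k) → FreeAlgebra ℤ (Idx k) → Prop
  | braid (i : Idx k) :
      AkRel k (FreeAlgebra.ι ℤ i * FreeAlgebra.ι ℤ (i + 1) * FreeAlgebra.ι ℤ i)
        (FreeAlgebra.ι ℤ (i + 1) * FreeAlgebra.ι ℤ i * FreeAlgebra.ι ℤ (i + 1))
  | comm (i j : Idx k) (h1 : i - j ≠ 1) (h2 : j - i ≠ 1) :
      AkRel k (FreeAlgebra.ι ℤ i * FreeAlgebra.ι ℤ j)
        (FreeAlgebra.ι ℤ j * FreeAlgebra.ι ℤ i)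

/-- The algebra `𝒜_k`. -/
abbrev Ak (k : ℕ) := RingQuot (AkRel k)

/-- The generator `A_i` of `𝒜_k`. -/
def Agen (k : ℕ) (i : Idx k) : Ak k := RingQuot.mkAlgHom ℤ (AkRel k) (FreeAlgebra.ι ℤ i)

/-- The element `A_{i₁} ⋯ A_{i_m}` of `𝒜_k` associated to a word. -/
def Aword (k : ℕ) (u : Word k) : Ak k := (u.map (Agen k)).prod

/-- The defining relations of the 0-Hecke algebra `ℋ_k`. -/
inductive HkRel (k : ℕ) : FreeAlgebra ℤ (Idx k) → FreeAlgebra ℤ (Idx k) → Prop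
  | braid (i : Idx k) :
      HkRel k (FreeAlgebra.ι ℤ i * FreeAlgebra.ι ℤ (i + 1) * FreeAlgebra.ι ℤ i)
        (FreeAlgebra.ι ℤ (i + 1) * FreeAlgebra.ι ℤ i * FreeAlgebra.ι ℤ (i + 1))
  | comm (i j : Idx k) (h1 : i - j ≠ 1) (h2 : j - i ≠ 1) :
      HkRel k (FreeAlgebra.ι ℤ i * FreeAlgebra.ι ℤ j)
        (FreeAlgebra.ι ℤ j * FreeAlgebra.ι ℤ i)
  | sq (i : Idx k) :
      HkRel k (FreeAlgebra.ι ℤ i * FreeAlgebra.ι ℤ i) (-(FreeAlgebra.ι ℤ i))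

/-- The 0-Hecke algebra `ℋ_k`. -/
abbrev Hk (k : ℕ) := RingQuot (HkRel k)

/-- The generator `H_i`. -/
def Hgen (k : ℕ) (i : Idx k) : Hk k := RingQuot.mkAlgHom ℤ (HkRel k) (FreeAlgebra.ι ℤ i)

/-- The element `H_{i₁} ⋯ H_{i_m}`. -/
def Hword (k : ℕ) (u : Word k) : Hk k := (u.map (Hgen k)).prod

/-- The defining relations of the nilCoxeter algebra `𝒩_k`. -/
inductive NkRel (k : ℕ) : FreeAlgebra ℤ (Idx k) → FreeAlgebra ℤ (Idx k) → Prop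
  | braid (i : Idx k) :
      NkRel k (FreeAlgebra.ι ℤ i * FreeAlgebra.ι ℤ (i + 1) * FreeAlgebra.ι ℤ i)
        (FreeAlgebra.ι ℤ (i + 1) * FreeAlgebra.ι ℤ i * FreeAlgebra.ι ℤ (i + 1))
  | comm (i j : Idx k) (h1 : i - j ≠ 1) (h2 : j - i ≠ 1) :
      NkRel k (FreeAlgebra.ι ℤ i * FreeAlgebra.ι ℤ j)
        (FreeAlgebra.ι ℤ j * FreeAlgebra.ι ℤ i)
  | sq (i : Idx k) :
      NkRel k (FreeAlgebra.ι ℤ i * FreeAlgebra.ι ℤ i) 0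

/-- The nilCoxeter algebra `𝒩_k`. -/
abbrev Nk (k : ℕ) := RingQuot (NkRel k)

/-- The generator `N_i`. -/
def Ngen (k : ℕ) (i : Idx k) : Nk k := RingQuot.mkAlgHom ℤ (NkRel k) (FreeAlgebra.ι ℤ i)

/-- The element `N_{i₁} ⋯ N_{i_m}`. -/
def Nword (k : ℕ) (u : Word k) : Nk k := (u.map (Ngen k)).prod

/-! ## The affine symmetric group -/

/-- The relators of the affine symmetric group `S̃_{k+1}`. -/
def CoxRels (k : ℕ) : Set (FreeGroup (Idx k)) :=
  {g | (∃ i : Idx k, g = FreeGroup.of i * FreeGroup.of i) ∨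
    (∃ i : Idx k,
      g = FreeGroup.of i * FreeGroup.of (i + 1) * FreeGroup.of i *
        (FreeGroup.of (i + 1) * FreeGroup.of i * FreeGroup.of (i + 1))⁻¹) ∨
    (∃ i j : Idx k, i - j ≠ 1 ∧ j - i ≠ 1 ∧
      g = FreeGroup.of i * FreeGroup.of j * (FreeGroup.of j * FreeGroup.of i)⁻¹)}

/-- The affine symmetric group `S̃_{k+1}`. -/
abbrev AffS (k : ℕ) := PresentedGroup (CoxRels k)

/-- The generator `s_i`. -/
def sgen (k : ℕ) (i : Idx k) : AffS k := PresentedGroup.of i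

/-- The product `s_{i₁} ⋯ s_{i_m}`. -/
def sword (k : ℕ) (u : Word k) : AffS k := (u.map (sgen k)).prod

/-- The Coxeter length of `w ∈ S̃_{k+1}`. -/
def len (k : ℕ) (w : AffS k) : ℕ :=
  sInf {m | ∃ u : Word k, u.length = m ∧ sword k u = w}

/-- `u` is a reduced word. -/
def IsReducedWord (k : ℕ) (u : Word k) : Prop := len k (sword k u) = u.length

/-- The finite symmetric group `S_{k+1} = ⟨s_1, …, s_k⟩` inside `S̃_{k+1}`. -/
def FinSub (k : ℕ) : Subgroup (AffS k) :=
  Subgroup.closure {g | ∃ i : Idx k, i ≠ 0 ∧ g = sgen k i}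

/-- `w` is a minimal-length coset representative of `S̃_{k+1}/S_{k+1}` (a Grassmannian
element). -/
def IsGrassmannian (k : ℕ) (w : AffS k) : Prop :=
  ∀ v : AffS k, w⁻¹ * v ∈ FinSub k → len k w ≤ len k v

/-! ## Anti-weak hook words -/

/-- Anti-weak hook word, first form: `i₁ < ⋯ < i_j > i_{j+1} > ⋯ > i_m`. -/
def IsAntiHookV (k : ℕ) (u : Word k) : Prop :=
  supp k u ≠ Finset.univ ∧
    ∃ (ds as : List ℕ) (v : ℕ),
      posList k u = ds ++ v :: as ∧
        List.Chain' (· < ·) (ds ++ [v]) ∧ List.Chain' (· > ·) (v :: as)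

/-- Anti-weak hook word, second form: `i₁ < ⋯ < i_j = i_{j+1} > ⋯ > i_m`. -/
def IsAntiHookU (k : ℕ) (u : Word k) : Prop :=
  supp k u ≠ Finset.univ ∧
    ∃ (ds as : List ℕ) (v : ℕ),
      posList k u = ds ++ v :: v :: as ∧
        List.Chain' (· < ·) (ds ++ [v]) ∧ List.Chain' (· > ·) (v :: as)

/-- Anti-weak hook word. -/
def IsAntiWeakHook (k : ℕ) (u : Word k) : Prop := IsAntiHookV k u ∨ IsAntiHookU k u

/-- Length of the maximal strictly increasing (w.r.t. `I_{supp u}`) initial segment of `u`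
(= the left side of an anti-weak hook word). -/
def incPrefixLen (k : ℕ) (u : Word k) : ℕ :=
  sSup {n | n ≤ u.length ∧
    List.Chain' (fun a b => pos k (supp k u) a < pos k (supp k u) b) (u.take n)}

/-- Length of the maximal strictly increasing (w.r.t. `I_{supp u}`) final segment of `u`
(= the right side of a weak hook word). -/
def incSuffixLen (k : ℕ) (u : Word k) : ℕ :=
  sSup {n | n ≤ u.length ∧
    List.Chain' (fun a b => pos k (supp k u) a < pos k (supp k u) b)
      (u.drop (u.length - n))}

/-! ## Noncommutative symmetric functions in `𝒜_k` -/

/-- The word underlying the cyclically decreasing element `d_A` (letters of `A` in decreasing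
position order, so that `A_{i+1}` occurs before `A_i` whenever `i, i+1 ∈ A`). -/
def dwordOf (k : ℕ) (A : Finset (Idx k)) : Word k :=
  (((A.image (pos k A)).sort (· ≤ ·)).reverse).map fun n => gap k A + 1 + (n : Idx k)

/-- The word underlying the cyclically increasing element `i_A`. -/
def iwordOf (k : ℕ) (A : Finset (Idx k)) : Word k :=
  ((A.image (pos k A)).sort (· ≤ ·)).map fun n => gap k A + 1 + (n : Idx k)

/-- The noncommutative homogeneous symmetric function `h_r = Σ_{|A| = r} d_A`. -/
def hFun (k r : ℕ) : Ak k :=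
  ∑ A ∈ Finset.powersetCard r (Finset.univ : Finset (Idx k)), Aword k (dwordOf k A)

/-- The noncommutative elementary symmetric function `e_r = Σ_{|A| = r} i_A`. -/
def eFun (k r : ℕ) : Ak k :=
  ∑ A ∈ Finset.powersetCard r (Finset.univ : Finset (Idx k)), Aword k (iwordOf k A)

/-- The noncommutative hook Schur function `s_{(r−i,1^i)}`. -/
def sHookFun (k r i : ℕ) : Ak k :=
  ∑ j ∈ Finset.range (i + 1), ((-1 : ℤ) ^ j) • (hFun k (r - i + j) * eFun k (i - j))

/-- The noncommutative power sum `p_r`. -/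
def pFun (k r : ℕ) : Ak k :=
  ∑ i ∈ Finset.range r, ((-1 : ℤ) ^ i) • sHookFun k r i

/-! ## Actions on the affine symmetric group -/

/-- The star action of a generator: `A_i * w = s_i w` if `l(s_i w) > l(w)`, else `w`. -/
def starG (k : ℕ) (i : Idx k) (w : AffS k) : AffS k :=
  if len k w < len k (sgen k i * w) then sgen k i * w else w

/-- The star action of a word: `A_{i₁}⋯A_{i_m} * w = A_{i₁} * (⋯ * (A_{i_m} * w))`. -/
def starW (k : ℕ) (u : Word k) (w : AffS k) : AffS k := u.foldr (starG k) w

/-- The dot action of a generator, with values in `S̃_{k+1} ∪ {0}`. -/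
def dotG (k : ℕ) (i : Idx k) : Option (AffS k) → Option (AffS k)
  | none => none
  | some w => if len k w < len k (sgen k i * w) then some (sgen k i * w) else none

/-- The dot action of a word. -/
def dotW (k : ℕ) (u : Word k) (o : Option (AffS k)) : Option (AffS k) :=
  u.foldr (dotG k) o

/-- Extension of an action datum `act : generator → S̃ → S̃ ∪ {0}` to `S̃ ∪ {0}`. -/
def actExt (k : ℕ) (act : Idx k → AffS k → Option (AffS k)) (i : Idx k) :
    Option (AffS k) → Option (AffS k)
  | none => none
  | some w => act i w

/-- Extension of an action datum to words. -/
def actW (k : ℕ) (act : Idx k → AffS k → Option (AffS k)) (u : Word k)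
    (o : Option (AffS k)) : Option (AffS k) :=
  u.foldr (actExt k act) o

/-! ## Rings and coefficients -/

/-- `(−1)^n` for an integer exponent `n`, in any ring. -/
def msign (R : Type*) [Ring R] (n : ℤ) : R := (((-1 : Rˣ) ^ n : Rˣ) : R)

/-- The power sum `p^R_r = Σ_{i=0}^{r−1} Σ_{j=0}^{i} (−1)^{i+j} h^R_{r−i+j} e^R_{i−j}` built from
Pieri data in a commutative ring. -/
def pR {R : Type*} [CommRing R] (h e : ℕ → R) (r : ℕ) : R :=
  ∑ i ∈ Finset.range r, ∑ j ∈ Finset.range (i + 1),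
    ((-1 : ℤ) ^ (i + j)) • (h (r - i + j) * e (i - j))

/-- The integer coefficient
`Σ_{i=0}^{r−1} (−1)^i |V^r_{i,wc} ∩ P| + Σ_{i=1}^{r−1} (−1)^i (r−i) |U^r_{i−1,wc} ∩ P|
 + Σ_{i=1}^{r−2} (−1)^i |U^r_{i−1,w̄c,left} ∩ P|`. -/
def MNcoeff (k r : ℕ) (P : Word k → Prop) : ℤ :=
  (∑ i ∈ Finset.range r, (-1 : ℤ) ^ i * ({u ∈ VSetWC k r (i : ℤ) | P u}.ncard : ℤ)) +
    (∑ i ∈ Finset.Icc 1 (r - 1),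
      (-1 : ℤ) ^ i * ((r : ℤ) - i) * ({u ∈ USetWC k r ((i : ℤ) - 1) | P u}.ncard : ℤ)) +
    ∑ i ∈ Finset.Icc 1 (r - 2),
      (-1 : ℤ) ^ i * ({u ∈ USetNWCL k r ((i : ℤ) - 1) | P u}.ncard : ℤ)

/-- The integer coefficient `Σ_{i=0}^{r−1} (−1)^i |V^r_{i,c} ∩ P|`. -/
def kcoeff (k r : ℕ) (P : Word k → Prop) : ℤ :=
  ∑ i ∈ Finset.range r, (-1 : ℤ) ^ i * ({u ∈ VSetC k r (i : ℤ) | P u}.ncard : ℤ)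

/-! ## Partitions, cores, bounded partitions -/

/-- A cell of a Young diagram: (row, column), `0`-indexed. -/
abbrev Cell := ℕ × ℕ

/-- A (finite) Young diagram, as a finite lower set of cells. -/
def IsYoung (S : Set Cell) : Prop :=
  S.Finite ∧ ∀ p ∈ S, ∀ q : Cell, q.1 ≤ p.1 → q.2 ≤ p.2 → q ∈ S

/-- The `(k+1)`-residue of a cell `(i,j)`, i.e. `j − i mod (k+1)`. -/
def res (k : ℕ) (c : Cell) : Idx k := (c.2 : Idx k) - (c.1 : Idx k)

/-- The hook length of a cell: arm + leg + 1. -/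
def hookLen (S : Set Cell) (c : Cell) : ℕ :=
  {j | c.2 < j ∧ (c.1, j) ∈ S}.ncard + {i | c.1 < i ∧ (i, c.2) ∈ S}.ncard + 1

/-- A `(k+1)`-core: a partition with no cell of hook length `k+1`. -/
def IsCore (k : ℕ) (S : Set Cell) : Prop :=
  IsYoung S ∧ ∀ c ∈ S, hookLen S c ≠ k + 1

/-- A `k`-bounded partition: every part is at most `k`. -/
def IsBounded (k : ℕ) (S : Set Cell) : Prop :=
  IsYoung S ∧ ∀ c ∈ S, c.2 < k

/-- A removable corner of `S`. -/
def Removable (S : Set Cell) (c : Cell) : Prop :=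
  c ∈ S ∧ (c.1 + 1, c.2) ∉ S ∧ (c.1, c.2 + 1) ∉ S

/-- An addable corner of `S`: a cell not in `S` whose addition yields a partition. -/
def Addable (S : Set Cell) (c : Cell) : Prop :=
  c ∉ S ∧ IsYoung (S ∪ {c})

/-- The map `𝔭` from `(k+1)`-cores to `k`-bounded partitions: row `i` of `𝔭(κ)` has as many
cells as there are cells of hook length at most `k` in row `i` of `κ`. -/
def pMap (k : ℕ) (S : Set Cell) : Set Cell :=
  {c | c.2 < {j | (c.1, j) ∈ S ∧ hookLen S (c.1, j) ≤ k}.ncard}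

/-- The inverse bijection `𝔭^{-1}` from `k`-bounded partitions to `(k+1)`-cores. -/
def pInv (k : ℕ) (lam : Set Cell) : Set Cell :=
  Function.invFunOn (pMap k) {S | IsCore k S} lam

/-- The transpose (conjugate) of a diagram. -/
def transposeSet (S : Set Cell) : Set Cell := {c | (c.2, c.1) ∈ S}

/-- The `k`-conjugate `λ^{(k)} = 𝔭((𝔭^{-1} λ)^t)`. -/
def kconj (k : ℕ) (lam : Set Cell) : Set Cell := pMap k (transposeSet (pInv k lam))

/-- A skew shape is a ribbon if it contains no `2×2` square. -/
def IsRibbon (D : Set Cell) : Prop :=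
  ∀ c : Cell, ¬((c.1, c.2) ∈ D ∧ (c.1 + 1, c.2) ∈ D ∧
    (c.1, c.2 + 1) ∈ D ∧ (c.1 + 1, c.2 + 1) ∈ D)

/-- A vertical strip: no two cells in the same row. -/
def IsVStrip (D : Set Cell) : Prop :=
  ∀ c ∈ D, ∀ c' ∈ D, c.1 = c'.1 → c = c'

/-- A horizontal strip: no two cells in the same column. -/
def IsHStrip (D : Set Cell) : Prop :=
  ∀ c ∈ D, ∀ c' ∈ D, c.2 = c'.2 → c = c'

/-- The height of a skew shape: the number of occupied rows minus the number of connected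
components; each connected component is counted by its unique last occupied row, i.e. an
occupied row sharing no column with the next row. -/
def htSkew (D : Set Cell) : ℕ :=
  {i : ℕ | ∃ j, (i, j) ∈ D}.ncard -
    {i : ℕ | (∃ j, (i, j) ∈ D) ∧ ¬∃ j, (i, j) ∈ D ∧ (i + 1, j) ∈ D}.ncard

/-- The set of `(k+1)`-residues of the cells of a skew shape. -/
def residSupp (k : ℕ) (D : Set Cell) : Finset (Idx k) :=
  Set.Finite.toFinset (Set.toFinite (res k '' D))

/-! ## Star and dot actions on cores and on `k`-bounded partitions -/

/-- The star action of `A_i` on `(k+1)`-cores together with `0`. -/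
def starC (k : ℕ) (i : Idx k) : Option (Set Cell) → Option (Set Cell)
  | none => none
  | some S =>
    if ∃ c, Addable S c ∧ res k c = i then some (S ∪ {c | Addable S c ∧ res k c = i})
    else if ∃ c, Removable S c ∧ res k c = i then some S
    else none

/-- The star action of a word on cores. -/
def starCW (k : ℕ) (u : Word k) (o : Option (Set Cell)) : Option (Set Cell) :=
  u.foldr (starC k) o

/-- The star action of a word on `k`-bounded partitions, transported through `𝔭`. -/
def starB (k : ℕ) (u : Word k) (lam : Set Cell) : Option (Set Cell) :=
  (starCW k u (some (pInv k lam))).map (pMap k)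

/-- The dot action of `A_i` on `(k+1)`-cores together with `0`. -/
def dotC (k : ℕ) (i : Idx k) : Option (Set Cell) → Option (Set Cell)
  | none => none
  | some S =>
    if ∃ c, Addable S c ∧ res k c = i then some (S ∪ {c | Addable S c ∧ res k c = i})
    else none

/-- The dot action of a word on cores. -/
def dotCW (k : ℕ) (u : Word k) (o : Option (Set Cell)) : Option (Set Cell) :=
  u.foldr (dotC k) o

/-- The dot action of a word on `k`-bounded partitions, transported through `𝔭`. -/
def dotB (k : ℕ) (u : Word k) (lam : Set Cell) : Option (Set Cell) :=
  (dotCW k u (some (pInv k lam))).map (pMap k)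

/-- The number of maximal segments of consecutive letters (w.r.t. the positions for `S`) of a
word `V`. -/
def numSegments (k : ℕ) (S : Finset (Idx k)) (V : Word k) : ℕ :=
  if V.length = 0 then 0
  else ((V.zip V.tail).countP fun p => decide (pos k S p.2 ≠ pos k S p.1 + 1)) + 1

/-- Conditions (K0)–(K4) of the Murnaghan–Nakayama rule for `K`-`k`-Schur functions. -/
def Kconds (k r : ℕ) (lam mu : Set Cell) : Prop :=
  lam ⊆ mu ∧ kconj k lam ⊆ kconj k mu ∧
    (mu \ lam).ncard ≤ r ∧
    IsRibbon (pInv k mu \ pInv k lam) ∧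
    (IsKConnectedSet k (residSupp k (pInv k mu \ pInv k lam)) ∨
      (residSupp k (pInv k mu \ pInv k lam)).card < r) ∧
    htSkew (mu \ lam) + htSkew (kconj k mu \ kconj k lam) < r

/-- Conditions (k0)–(k4) of the Murnaghan–Nakayama rule for `k`-Schur functions. -/
def kconds (k r : ℕ) (lam mu : Set Cell) : Prop :=
  lam ⊆ mu ∧ kconj k lam ⊆ kconj k mu ∧
    (mu \ lam).ncard = r ∧
    IsRibbon (pInv k mu \ pInv k lam) ∧
    IsKConnectedSet k (residSupp k (pInv k mu \ pInv k lam)) ∧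
    htSkew (mu \ lam) + htSkew (kconj k mu \ kconj k lam) = r - 1


lemma sword_nil (k : ℕ) : sword k [] = 1 := rfl
lemma sword_cons (k : ℕ) (i : Idx k) (u : Word k) : sword k (i :: u) = sgen k i * sword k u := by
  simp [sword]
lemma sword_append (k : ℕ) (u v : Word k) : sword k (u ++ v) = sword k u * sword k v := by
  simp [sword]
lemma sgen_sq (k : ℕ) (i : Idx k) : sgen k i * sgen k i = 1 := by
  have h : FreeGroup.of i * FreeGroup.of i ∈ CoxRels k := Or.inl ⟨i, rfl⟩
  have := PresentedGroup.one_of_mem h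
  simpa [sgen, PresentedGroup.of] using this
lemma sgen_inv (k : ℕ) (i : Idx k) : (sgen k i)⁻¹ = sgen k i :=
  inv_eq_of_mul_eq_one_left (sgen_sq k i)
lemma sgen_comm (k : ℕ) (i j : Idx k) (h1 : i - j ≠ 1) (h2 : j - i ≠ 1) :
    sgen k i * sgen k j = sgen k j * sgen k i := by
  have h : FreeGroup.of i * FreeGroup.of j * (FreeGroup.of j * FreeGroup.of i)⁻¹ ∈ CoxRels k :=
    Or.inr (Or.inr ⟨i, j, h1, h2, rfl⟩)
  have := PresentedGroup.one_of_mem h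
  rw [map_mul, map_inv, mul_inv_eq_one] at this
  simpa [sgen, PresentedGroup.of] using this
lemma sword_reverse (k : ℕ) (u : Word k) : sword k u.reverse = (sword k u)⁻¹ := by
  induction u with
  | nil => simp [sword]
  | cons i u ih => simp [sword_append, sword_cons, ih, sword_nil, sgen_inv]
lemma sword_surj (k : ℕ) (w : AffS k) : ∃ u : Word k, sword k u = w := by
  have hw : w ∈ Subgroup.closure (Set.range (PresentedGroup.of : Idx k → AffS k)) := by
    rw [PresentedGroup.closure_range_of]; trivial
  induction hw using Subgroup.closure_induction with
  | mem x hx => obtain ⟨i, rfl⟩ := hx; exact ⟨[i], by simp [sword, sgen]⟩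
  | one => exact ⟨[], rfl⟩
  | mul x y _ _ hx hy =>
    obtain ⟨u, rfl⟩ := hx; obtain ⟨v, rfl⟩ := hy; exact ⟨u ++ v, sword_append k u v⟩
  | inv x _ hx => obtain ⟨u, rfl⟩ := hx; exact ⟨u.reverse, sword_reverse k u⟩
lemma len_mul_le (k : ℕ) (u : Word k) (w : AffS k) :
    len k (sword k u * w) ≤ len k w + u.length := by
  have hne : {m | ∃ v : Word k, v.length = m ∧ sword k v = w}.Nonempty := by
    obtain ⟨v, hv⟩ := sword_surj k w
    exact ⟨_, v, rfl, hv⟩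
  obtain ⟨v, hv, hvw⟩ := Nat.sInf_mem hne
  refine Nat.sInf_le ⟨u ++ v, ?_, ?_⟩
  · rw [List.length_append, hv, add_comm]; rfl
  · rw [sword_append, hvw]
lemma len_sgen_le (k : ℕ) (i : Idx k) (w : AffS k) : len k (sgen k i * w) ≤ len k w + 1 := by
  simpa [sword] using len_mul_le k [i] w
lemma dotW_eq (k : ℕ) (u : Word k) (w : AffS k) : dotW k u (some w) =
    if len k (sword k u * w) = len k w + u.length then some (sword k u * w) else none := by
  induction u with
  | nil => simp [dotW, sword]
  | cons i u ih =>
    have e : dotW k (i :: u) (some w) = dotG k i (dotW k u (some w)) := rfl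
    rw [e, ih, sword_cons, mul_assoc]
    have h1 := len_mul_le k u w
    have h2 := len_sgen_le k i (sword k u * w)
    split_ifs with h3 h4 h4
    · simp only [dotG]; rw [if_pos]; simp at h4; omega
    · simp only [dotG]; rw [if_neg]; simp at h4; omega
    · simp at h4; omega
    · rfl

lemma dotW_append (k : ℕ) (u v : Word k) (o : Option (AffS k)) :
    dotW k (u ++ v) o = dotW k u (dotW k v o) := by simp [dotW]
lemma dotW_none (k : ℕ) (u : Word k) : dotW k u none = none := by
  induction u with
  | nil => rfl
  | cons i u ih =>
    have e : dotW k (i :: u) none = dotG k i (dotW k u none) := rfl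
    rw [e, ih]; rfl

lemma grass_of_dot (k : ℕ) (u : Word k) (w w' : AffS k) (h : dotW k u (some w) = some w')
    (hg : IsGrassmannian k w') : IsGrassmannian k w := by
  rw [dotW_eq] at h
  split_ifs at h with h1
  simp only [Option.some.injEq] at h
  subst h
  intro v hv
  have h2 := hg (sword k u * v) (by simpa [mul_assoc] using hv)
  have h3 := len_mul_le k u v
  omega

/-- The value of a word acting on `w`. -/
def fval {R : Type*} [CommRing R] (k : ℕ) (s : AffS k → R) (u : Word k) (w : AffS k) : R :=
  (dotW k u (some w)).elim 0 fun w' => if IsGrassmannian k w' then s w' else 0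

lemma fval_congr {R : Type*} [CommRing R] (k : ℕ) (s : AffS k → R) (u v : Word k) (w : AffS k)
    (h1 : sword k u = sword k v) (h2 : u.length = v.length) : fval k s u w = fval k s v w := by
  simp only [fval, dotW_eq, h1, h2]

lemma fval_zero {R : Type*} [CommRing R] (k : ℕ) (s : AffS k → R) (u v : Word k) (w : AffS k)
    (h1 : sword k u = sword k v) (h2 : v.length < u.length) : fval k s u w = 0 := by
  have := len_mul_le k v w
  rw [fval, dotW_eq, h1, if_neg (by omega)]; rfl

/-! positions -/
def posg (k : ℕ) (g i : Idx k) : ℕ := (i - g - 1).val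
def decW (k : ℕ) (g : Idx k) (A : Finset (Idx k)) : Word k :=
  (((A.image (posg k g)).sort (· ≤ ·)).reverse).map fun n : ℕ => g + 1 + (n : Idx k)
def incW (k : ℕ) (g : Idx k) (A : Finset (Idx k)) : Word k :=
  ((A.image (posg k g)).sort (· ≤ ·)).map fun n : ℕ => g + 1 + (n : Idx k)
lemma dwordOf_eq (k : ℕ) (A : Finset (Idx k)) : dwordOf k A = decW k (gap k A) A := by
  simp only [dwordOf, decW, List.bind_eq_flatMap, List.pure_def, ← List.map_eq_flatMap, List.map_map]
  rfl
lemma iwordOf_eq (k : ℕ) (A : Finset (Idx k)) : iwordOf k A = incW k (gap k A) A := by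
  simp only [iwordOf, incW, List.bind_eq_flatMap, List.pure_def, ← List.map_eq_flatMap, List.map_map]
  rfl
lemma pos_eq (k : ℕ) (S : Finset (Idx k)) : pos k S = posg k (gap k S) := rfl
lemma dec_inc (k : ℕ) (g : Idx k) (A : Finset (Idx k)) : decW k g A = (incW k g A).reverse := by
  simp [decW, incW]
lemma posg_inv (k : ℕ) (g i : Idx k) : g + 1 + (posg k g i : Idx k) = i := by
  simp [posg]
lemma posg_inj (k : ℕ) (g : Idx k) : Function.Injective (posg k g) := by
  intro i j h
  rw [← posg_inv k g i, h, posg_inv]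
lemma posg_le (k : ℕ) (g i : Idx k) : posg k g i ≤ k := Nat.lt_succ_iff.1 (ZMod.val_lt _)
lemma posg_gap (k : ℕ) (g : Idx k) : posg k g g = k := by
  have : g - g - 1 = ((k : ℕ) : Idx k) := by
    have : ((k + 1 : ℕ) : Idx k) = 0 := ZMod.natCast_self _
    push_cast at this
    linear_combination -this
  rw [posg, this, ZMod.val_natCast_of_lt (Nat.lt_succ_self k)]
lemma posg_succ (k : ℕ) (g i : Idx k) (h : i ≠ g) : posg k g (i + 1) = posg k g i + 1 := by
  have hlt : posg k g i + 1 < k + 1 := by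
    have := posg_le k g i
    have : posg k g i ≠ k := fun e => h (posg_inj k g (e.trans (posg_gap k g).symm))
    omega
  have : i + 1 - g - 1 = ((posg k g i + 1 : ℕ) : Idx k) := by
    push_cast; linear_combination - (posg_inv k g i)
  rw [posg, this, ZMod.val_natCast_of_lt hlt]
lemma gap_not_mem (k : ℕ) (S : Finset (Idx k)) (h : S ≠ Finset.univ) : gap k S ∉ S := by
  have : ∃ m : ℕ, m ≤ k ∧ (m : Idx k) ∉ S := by
    by_contra hc
    push Not at hc
    refine h (Finset.eq_univ_iff_forall.2 fun x => ?_)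
    have := hc x.val (Nat.lt_succ_iff.1 (ZMod.val_lt _))
    simpa using this
  rw [gap, gapNat, dif_pos this]
  exact (Nat.find_spec this).2

lemma incW_map (k : ℕ) (g : Idx k) (A : Finset (Idx k)) :
    (incW k g A).map (posg k g) = (A.image (posg k g)).sort (· ≤ ·) := by
  rw [incW, List.map_map]
  conv_rhs => rw [← List.map_id ((A.image (posg k g)).sort (· ≤ ·))]
  refine List.map_congr_left fun n hn => ?_
  rw [Finset.mem_sort, Finset.mem_image] at hn
  obtain ⟨i, -, rfl⟩ := hn
  simp [posg_inv]
lemma mem_incW (k : ℕ) (g : Idx k) (A : Finset (Idx k)) (x : Idx k) : x ∈ incW k g A ↔ x ∈ A := by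
  have h : posg k g x ∈ (incW k g A).map (posg k g) ↔ x ∈ A := by
    rw [incW_map, Finset.mem_sort, Finset.mem_image]
    exact ⟨fun ⟨i, hi, e⟩ => posg_inj k g e ▸ hi, fun h => ⟨x, h, rfl⟩⟩
  rw [← h, List.mem_map_of_injective (posg_inj k g)]
lemma incW_chain (k : ℕ) (g : Idx k) (A : Finset (Idx k)) :
    (incW k g A).Pairwise (fun a b => posg k g a < posg k g b) := by
  have := Finset.sortedLT_sort (A.image (posg k g))
  rw [← incW_map] at this
  exact List.pairwise_map.1 this.pairwise
lemma incW_unique (k : ℕ) (g : Idx k) (A : Finset (Idx k)) (l : Word k)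
    (h : l.Pairwise (fun a b => posg k g a < posg k g b)) (hm : ∀ x, x ∈ l ↔ x ∈ A) :
    l = incW k g A := by
  refine List.Perm.eq_of_pairwise (le := fun a b => posg k g a < posg k g b) ?_ h (incW_chain k g A) ?_
  · intro a b _ _ h1 h2; omega
  · rw [List.perm_ext_iff_of_nodup]
    · intro a; rw [hm, mem_incW]
    · exact h.imp fun h e => by subst e; omega
    · exact (incW_chain k g A).imp fun h e => by subst e; omega
lemma incW_length (k : ℕ) (g : Idx k) (A : Finset (Idx k)) : (incW k g A).length = A.card := by
  rw [incW, List.length_map, Finset.length_sort, Finset.card_image_of_injective _ (posg_inj k g)]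

lemma decW_length (k : ℕ) (g : Idx k) (A : Finset (Idx k)) : (decW k g A).length = A.card := by
  rw [dec_inc, List.length_reverse, incW_length]
lemma mem_decW (k : ℕ) (g : Idx k) (A : Finset (Idx k)) (x : Idx k) : x ∈ decW k g A ↔ x ∈ A := by
  rw [dec_inc, List.mem_reverse, mem_incW]
lemma decW_chain (k : ℕ) (g : Idx k) (A : Finset (Idx k)) :
    (decW k g A).Pairwise (fun a b => posg k g a > posg k g b) := by
  rw [dec_inc, List.pairwise_reverse]; exact incW_chain k g A

lemma sword_comm_all (k : ℕ) (c : Idx k) (u : Word k)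
    (h : ∀ d ∈ u, c - d ≠ 1 ∧ d - c ≠ 1) : sword k u * sgen k c = sgen k c * sword k u := by
  induction u with
  | nil => simp [sword_nil]
  | cons d u ih =>
    have h1 := h d (by simp)
    rw [sword_cons, mul_assoc, ih fun d hd => h d (by simp [hd]), ← mul_assoc, ← mul_assoc,
      sgen_comm k c d h1.1 h1.2]

lemma sword_inc_erase (k : ℕ) (g : Idx k) (A : Finset (Idx k)) (hg : g ∉ A) (c : Idx k)
    (hc : c ∈ A) (hc1 : c - 1 ∉ A) :
    sword k (incW k g A) = sgen k c * sword k (incW k g (A.erase c)) := by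
  obtain ⟨l1, l2, hl⟩ := List.append_of_mem ((mem_incW k g A c).2 hc)
  have hp := incW_chain k g A
  rw [hl] at hp
  have he : l1 ++ l2 = incW k g (A.erase c) := by
    refine incW_unique k g _ _ (hp.sublist (by simp)) fun x => ?_
    have hx := mem_incW k g A x
    rw [hl] at hx
    rw [Finset.mem_erase, ← hx]
    have hxc : x ∈ l1 ++ l2 → x ≠ c := by
      rintro h rfl
      rw [List.pairwise_append, List.pairwise_cons] at hp
      rcases List.mem_append.1 h with h | h
      · exact lt_irrefl _ (hp.2.2 x h x (by simp))
      · exact lt_irrefl _ (hp.2.1.1 x h)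
    simp only [List.mem_append, List.mem_cons] at hxc ⊢
    tauto
  rw [hl, ← he, sword_append, sword_append, sword_cons, ← mul_assoc, ← mul_assoc,
    sword_comm_all]
  intro d hd
  have hdA : d ∈ A := (mem_incW k g A d).1 (by rw [hl]; simp [hd])
  have hlt : posg k g d < posg k g c := (List.pairwise_append.1 hp).2.2 d hd c (by simp)
  constructor
  · intro h
    apply hc1
    have : c - 1 = d := by linear_combination h
    rwa [this]
  · intro h
    have : d = c + 1 := by linear_combination h
    rw [this, posg_succ k g c (fun e => hg (e ▸ hc))] at hlt
    omega

lemma exists_bot (k : ℕ) (g : Idx k) (A : Finset (Idx k)) (hg : g ∉ A) (hA : A.Nonempty) :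
    ∃ c ∈ A, c - 1 ∉ A ∧ ∀ x ∈ A, posg k g c ≤ posg k g x := by
  obtain ⟨c, hc, hm⟩ := A.exists_min_image (posg k g) hA
  refine ⟨c, hc, fun h => ?_, hm⟩
  have h1 := hm _ h
  have h2 := posg_succ k g (c - 1) (fun e => hg (e ▸ h))
  rw [sub_add_cancel] at h2
  omega

lemma sword_inc_indep (k : ℕ) (n : ℕ) : ∀ (A : Finset (Idx k)) (g g' : Idx k), A.card = n →
    g ∉ A → g' ∉ A → sword k (incW k g A) = sword k (incW k g' A) := by
  induction n with
  | zero =>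
    intro A g g' h _ _
    have : A = ∅ := Finset.card_eq_zero.1 h
    subst this
    simp [incW]
  | succ n ih =>
    intro A g g' h hg hg'
    obtain ⟨c, hc, hc1, -⟩ := exists_bot k g A hg (Finset.card_pos.1 (by omega))
    rw [sword_inc_erase k g A hg c hc hc1, sword_inc_erase k g' A hg' c hc hc1,
      ih (A.erase c) g g' (by rw [Finset.card_erase_of_mem hc]; omega)
        (fun h => hg (Finset.mem_of_mem_erase h)) (fun h => hg' (Finset.mem_of_mem_erase h))]

lemma sword_iword (k : ℕ) (A : Finset (Idx k)) (g : Idx k) (hg : g ∉ A) :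
    sword k (iwordOf k A) = sword k (incW k g A) := by
  rw [iwordOf_eq]
  refine sword_inc_indep k _ A _ _ rfl (gap_not_mem k A ?_) hg
  rintro rfl; simp at hg

lemma sword_dword (k : ℕ) (A : Finset (Idx k)) (g : Idx k) (hg : g ∉ A) :
    sword k (dwordOf k A) = sword k (decW k g A) := by
  rw [dwordOf_eq, dec_inc, dec_inc, sword_reverse, sword_reverse, ← iwordOf_eq,
    sword_iword k A g hg]

lemma iword_erase (k : ℕ) (A : Finset (Idx k)) (g : Idx k) (hg : g ∉ A) (c : Idx k)
    (hc : c ∈ A) (hc1 : c - 1 ∉ A) :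
    sword k (iwordOf k A) = sgen k c * sword k (iwordOf k (A.erase c)) := by
  rw [sword_iword k A g hg, sword_iword k (A.erase c) g (fun h => hg (Finset.mem_of_mem_erase h)),
    sword_inc_erase k g A hg c hc hc1]

lemma dword_erase (k : ℕ) (A : Finset (Idx k)) (g : Idx k) (hg : g ∉ A) (c : Idx k)
    (hc : c ∈ A) (hc1 : c - 1 ∉ A) :
    sword k (dwordOf k A) = sword k (dwordOf k (A.erase c)) * sgen k c := by
  have h := iword_erase k A g hg c hc hc1
  rw [dwordOf_eq, dec_inc, sword_reverse, ← iwordOf_eq, h, dwordOf_eq, dec_inc, sword_reverse,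
    ← iwordOf_eq, mul_inv_rev, sgen_inv]

lemma dword_length (k : ℕ) (A : Finset (Idx k)) : (dwordOf k A).length = A.card := by
  rw [dwordOf_eq, decW_length]
lemma iword_length (k : ℕ) (A : Finset (Idx k)) : (iwordOf k A).length = A.card := by
  rw [iwordOf_eq, incW_length]

/-- value of a pair -/
def Fp {R : Type*} [CommRing R] (k : ℕ) (s : AffS k → R) (w : AffS k)
    (p : Finset (Idx k) × Finset (Idx k)) : R :=
  fval k s (dwordOf k p.1 ++ iwordOf k p.2) w

lemma Fp_zero {R : Type*} [CommRing R] (k : ℕ) (s : AffS k → R) (w : AffS k)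
    (A B : Finset (Idx k)) (g c : Idx k) (hg : g ∉ A ∪ B) (hA : c ∈ A) (hB : c ∈ B)
    (hc : c - 1 ∉ A ∪ B) : Fp k s w (A, B) = 0 := by
  simp only [Finset.mem_union, not_or] at hg hc
  refine fval_zero k s _ (dwordOf k (A.erase c) ++ iwordOf k (B.erase c)) w ?_ ?_
  · simp only [sword_append]
    rw [dword_erase k A g hg.1 c hA hc.1, iword_erase k B g hg.2 c hB hc.2, mul_assoc,
      ← mul_assoc (sgen k c), sgen_sq, one_mul]
  · simp only [List.length_append, dword_length, iword_length]
    have := Finset.card_erase_lt_of_mem hA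
    have := Finset.card_erase_lt_of_mem hB
    omega

lemma Fp_toggle {R : Type*} [CommRing R] (k : ℕ) (s : AffS k → R) (w : AffS k)
    (A B : Finset (Idx k)) (g c : Idx k) (hg : g ∉ A ∪ B) (hA : c ∈ A) (hB : c ∉ B)
    (hc : c - 1 ∉ A ∪ B) (hk : 1 ≤ k) : Fp k s w (A.erase c, insert c B) = Fp k s w (A, B) := by
  simp only [Finset.mem_union, not_or] at hg hc
  have hcc : c - 1 ≠ c := by
    intro h
    have h10 : (1 : Idx k) = 0 := by linear_combination - h
    have : Fact (1 < k + 1) := ⟨by omega⟩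
    exact one_ne_zero h10
  refine fval_congr k s _ _ w ?_ ?_
  · simp only [sword_append]
    rw [dword_erase k A g hg.1 c hA hc.1, iword_erase k (insert c B) g
      (by rw [Finset.mem_insert, not_or]; exact ⟨fun e => hg.1 (e ▸ hA), hg.2⟩) c
      (Finset.mem_insert_self _ _)
      (by rw [Finset.mem_insert, not_or]; exact ⟨hcc, hc.2⟩), Finset.erase_insert hB, mul_assoc]
  · simp only [List.length_append, dword_length, iword_length, Finset.card_erase_of_mem hA,
      Finset.card_insert_of_notMem hB]
    have := Finset.card_pos.2 ⟨c, hA⟩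
    omega

lemma toggle_sum {R : Type*} [CommRing R] (k : ℕ) (hk : 1 ≤ k) (s : AffS k → R) (w : AffS k)
    (Q : Finset (Finset (Idx k) × Finset (Idx k))) (c : Finset (Idx k) → Idx k)
    (φ : Finset (Idx k) × Finset (Idx k) → R)
    (hQ0 : ∀ p ∈ Q, p.1 ∪ p.2 ≠ Finset.univ)
    (hQ1 : ∀ p ∈ Q, c (p.1 ∪ p.2) ∈ p.1 ∪ p.2 ∧ c (p.1 ∪ p.2) - 1 ∉ p.1 ∪ p.2)
    (hQ2 : ∀ p ∈ Q, c (p.1 ∪ p.2) ∈ p.1 → c (p.1 ∪ p.2) ∉ p.2 →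
      (p.1.erase (c (p.1 ∪ p.2)), insert (c (p.1 ∪ p.2)) p.2) ∈ Q)
    (hQ3 : ∀ p ∈ Q, c (p.1 ∪ p.2) ∉ p.1 → c (p.1 ∪ p.2) ∈ p.2 →
      (insert (c (p.1 ∪ p.2)) p.1, p.2.erase (c (p.1 ∪ p.2))) ∈ Q) :
    ∑ p ∈ Q, φ p * Fp k s w p =
      ∑ p ∈ Q.filter (fun p => c (p.1 ∪ p.2) ∈ p.1 ∧ c (p.1 ∪ p.2) ∉ p.2),
        (φ p + φ (p.1.erase (c (p.1 ∪ p.2)), insert (c (p.1 ∪ p.2)) p.2)) * Fp k s w p := by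
  simp only [add_mul]
  rw [Finset.sum_add_distrib,
    ← Finset.sum_filter_add_sum_filter_not Q (fun p => c (p.1 ∪ p.2) ∈ p.1 ∧ c (p.1 ∪ p.2) ∉ p.2)]
  congr 1
  have h0 : ∑ p ∈ Q.filter (fun p => ¬ (c (p.1 ∪ p.2) ∈ p.1 ∧ c (p.1 ∪ p.2) ∉ p.2)),
      φ p * Fp k s w p = ∑ p ∈ Q.filter (fun p => c (p.1 ∪ p.2) ∉ p.1 ∧ c (p.1 ∪ p.2) ∈ p.2),
      φ p * Fp k s w p := by
    symm
    apply Finset.sum_subset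
    · intro p
      simp only [Finset.mem_filter]
      tauto
    · intro p hp hp'
      simp only [Finset.mem_filter] at hp hp'
      have h1 := hQ1 p hp.1
      have h2 := Finset.mem_union.1 h1.1
      have h3 : c (p.1 ∪ p.2) ∈ p.1 ∧ c (p.1 ∪ p.2) ∈ p.2 := by tauto
      obtain ⟨A, B⟩ := p
      rw [Fp_zero k s w A B _ _ (gap_not_mem k _ (hQ0 _ hp.1)) h3.1 h3.2 h1.2, mul_zero]
  rw [h0]
  have hu1 : ∀ (A B : Finset (Idx k)) (x : Idx k), x ∈ A → A.erase x ∪ insert x B = A ∪ B := by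
    intro A B x hx
    rw [Finset.union_insert, ← Finset.insert_union, Finset.insert_erase hx]
  have hu2 : ∀ (A B : Finset (Idx k)) (x : Idx k), x ∈ B → insert x A ∪ B.erase x = A ∪ B := by
    intro A B x hx
    rw [Finset.insert_union, ← Finset.union_insert, Finset.insert_erase hx]
  refine Finset.sum_nbij' (fun p => (insert (c (p.1 ∪ p.2)) p.1, p.2.erase (c (p.1 ∪ p.2))))
    (fun p => (p.1.erase (c (p.1 ∪ p.2)), insert (c (p.1 ∪ p.2)) p.2)) ?_ ?_ ?_ ?_ ?_
  · rintro ⟨A, B⟩ hp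
    rw [Finset.mem_filter] at hp ⊢
    refine ⟨hQ3 _ hp.1 hp.2.1 hp.2.2, ?_⟩
    dsimp only at hp ⊢
    rw [hu2 A B _ hp.2.2]
    simp
  · rintro ⟨A, B⟩ hp
    rw [Finset.mem_filter] at hp ⊢
    refine ⟨hQ2 _ hp.1 hp.2.1 hp.2.2, ?_⟩
    dsimp only at hp ⊢
    rw [hu1 A B _ hp.2.1]
    simp
  · rintro ⟨A, B⟩ hp
    rw [Finset.mem_filter] at hp
    dsimp only at hp ⊢
    rw [hu2 A B _ hp.2.2, Finset.erase_insert hp.2.1, Finset.insert_erase hp.2.2]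
  · rintro ⟨A, B⟩ hp
    rw [Finset.mem_filter] at hp
    dsimp only at hp ⊢
    rw [hu1 A B _ hp.2.1, Finset.erase_insert hp.2.2, Finset.insert_erase hp.2.1]
  · rintro ⟨A, B⟩ hp
    rw [Finset.mem_filter] at hp
    have h1 := hQ1 _ hp.1
    have h0 := hQ0 _ hp.1
    dsimp only at hp h1 h0 ⊢
    rw [hu2 A B _ hp.2.2, Finset.erase_insert hp.2.1, Finset.insert_erase hp.2.2]
    rw [← Fp_toggle k s w (insert (c (A ∪ B)) A) (B.erase (c (A ∪ B))) (gap k (A ∪ B)) (c (A ∪ B))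
      (by rw [hu2 A B _ hp.2.2]; exact gap_not_mem k _ h0) (by simp) (by simp)
      (by rw [hu2 A B _ hp.2.2]; exact h1.2) hk, Finset.erase_insert hp.2.1,
      Finset.insert_erase hp.2.2]

def mbot (k : ℕ) (S : Finset (Idx k)) : Idx k :=
  if h : gap k S ∉ S ∧ S.Nonempty then (exists_bot k (gap k S) S h.1 h.2).choose else 0

lemma mbot_spec (k : ℕ) (S : Finset (Idx k)) (h1 : S ≠ Finset.univ) (h2 : S.Nonempty) :
    mbot k S ∈ S ∧ mbot k S - 1 ∉ S ∧ ∀ x ∈ S, pos k S (mbot k S) ≤ pos k S x := by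
  have h : gap k S ∉ S ∧ S.Nonempty := ⟨gap_not_mem k S h1, h2⟩
  rw [mbot, dif_pos h]
  exact (exists_bot k (gap k S) S h.1 h.2).choose_spec

lemma exists_cgap (k : ℕ) (S : Finset (Idx k)) (h1 : S ≠ Finset.univ)
    (h2 : ¬ IsKConnectedSet k S) : ∃ c ∈ S, c - 1 ∉ S ∧ c ≠ mbot k S := by
  simp only [IsKConnectedSet, not_and, not_forall] at h2
  obtain ⟨i, hi, j, hj, m, hm1, hm2, hm⟩ := h2 h1
  have hg := gap_not_mem k S h1
  rw [pos_eq] at hm1 hm2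
  have hne : (S.filter fun x => posg k (gap k S) m < posg k (gap k S) x).Nonempty := by
    refine ⟨j, Finset.mem_filter.2 ⟨hj, lt_of_le_of_ne hm2 fun e => hm ?_⟩⟩
    rwa [posg_inj k _ e]
  obtain ⟨c, hc, hmin⟩ := Finset.exists_min_image _ (posg k (gap k S)) hne
  rw [Finset.mem_filter] at hc
  refine ⟨c, hc.1, fun h => ?_, fun e => ?_⟩
  · have h2 := posg_succ k (gap k S) (c - 1) (fun e => hg (e ▸ h))
    rw [sub_add_cancel] at h2
    have h3 : posg k (gap k S) m ≠ posg k (gap k S) (c - 1) := fun e => hm (posg_inj k _ e ▸ h)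
    have := hmin (c - 1) (Finset.mem_filter.2 ⟨h, by omega⟩)
    omega
  · have := (mbot_spec k S h1 ⟨i, hi⟩).2.2 i hi
    rw [pos_eq, ← e] at this
    omega

def cgap (k : ℕ) (S : Finset (Idx k)) : Idx k :=
  if h : S ≠ Finset.univ ∧ ¬ IsKConnectedSet k S then (exists_cgap k S h.1 h.2).choose else 0

lemma cgap_spec (k : ℕ) (S : Finset (Idx k)) (h1 : S ≠ Finset.univ)
    (h2 : ¬ IsKConnectedSet k S) : cgap k S ∈ S ∧ cgap k S - 1 ∉ S ∧ cgap k S ≠ mbot k S := by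
  have h : S ≠ Finset.univ ∧ ¬ IsKConnectedSet k S := ⟨h1, h2⟩
  rw [cgap, dif_pos h]
  exact (exists_cgap k S h.1 h.2).choose_spec

def PP (k r : ℕ) : Finset (Finset (Idx k) × Finset (Idx k)) :=
  Finset.univ.filter fun p => p.1.card + p.2.card = r

def TT (k r : ℕ) : Finset (Finset (Idx k) × Finset (Idx k)) :=
  (PP k r).filter fun p => mbot k (p.1 ∪ p.2) ∈ p.1 ∧ mbot k (p.1 ∪ p.2) ∉ p.2

lemma PP_proper (k r : ℕ) (hr : r ≤ k) (p) (hp : p ∈ PP k r) : p.1 ∪ p.2 ≠ Finset.univ := by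
  intro h
  have h1 := Finset.card_union_le p.1 p.2
  rw [h, Finset.card_univ, ZMod.card] at h1
  have := (Finset.mem_filter.1 hp).2
  omega

lemma PP_nonempty (k r : ℕ) (hr : 1 ≤ r) (p) (hp : p ∈ PP k r) : (p.1 ∪ p.2).Nonempty := by
  rw [Finset.nonempty_iff_ne_empty]
  intro h
  rw [Finset.union_eq_empty] at h
  have := (Finset.mem_filter.1 hp).2
  rw [h.1, h.2] at this
  simp at this
  omega

lemma card_t1 {α : Type*} [DecidableEq α] (A B : Finset α) (c : α) (h1 : c ∈ A) (h2 : c ∉ B) :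
    (A.erase c).card + (insert c B).card = A.card + B.card := by
  rw [Finset.card_erase_of_mem h1, Finset.card_insert_of_notMem h2]
  have := Finset.card_pos.2 ⟨c, h1⟩
  omega
lemma un_t1 {α : Type*} [DecidableEq α] (A B : Finset α) (c : α) (h1 : c ∈ A) :
    A.erase c ∪ insert c B = A ∪ B := by
  rw [Finset.union_insert, ← Finset.insert_union, Finset.insert_erase h1]
lemma un_t2 {α : Type*} [DecidableEq α] (A B : Finset α) (c : α) (h1 : c ∈ B) :
    insert c A ∪ B.erase c = A ∪ B := by
  rw [Finset.insert_union, ← Finset.union_insert, Finset.insert_erase h1]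

lemma step1 {R : Type*} [CommRing R] (k r : ℕ) (hr1 : 1 ≤ r) (hrk : r ≤ k) (s : AffS k → R)
    (w : AffS k) :
    ∑ p ∈ PP k r, ((-1) ^ p.2.card * (p.1.card : R)) * Fp k s w p =
      ∑ p ∈ TT k r, (-1) ^ p.2.card * Fp k s w p := by
  rw [toggle_sum k (by omega) s w (PP k r) (mbot k) (fun p => (-1) ^ p.2.card * (p.1.card : R))
    (PP_proper k r hrk)]
  · refine Finset.sum_congr rfl fun p hp => ?_
    have hp := (Finset.mem_filter.1 hp).2
    congr 1
    dsimp only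
    rw [Finset.card_erase_of_mem hp.1, Finset.card_insert_of_notMem hp.2,
      Nat.cast_sub (Finset.card_pos.2 ⟨_, hp.1⟩)]
    push_cast
    ring
  · intro p hp
    have := mbot_spec k _ (PP_proper k r hrk p hp) (PP_nonempty k r hr1 p hp)
    exact ⟨this.1, this.2.1⟩
  · intro p hp h1 h2
    simp only [PP, Finset.mem_filter, Finset.mem_univ, true_and] at hp ⊢
    rw [card_t1 _ _ _ h1 h2, hp]
  · intro p hp h1 h2
    simp only [PP, Finset.mem_filter, Finset.mem_univ, true_and] at hp ⊢
    rw [add_comm, card_t1 _ _ _ h2 h1, add_comm, hp]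

lemma step2 {R : Type*} [CommRing R] (k r : ℕ) (hr1 : 1 ≤ r) (hrk : r ≤ k) (s : AffS k → R)
    (w : AffS k) :
    ∑ p ∈ TT k r, (-1) ^ p.2.card * Fp k s w p =
      ∑ p ∈ (TT k r).filter (fun p => IsKConnectedSet k (p.1 ∪ p.2)),
        (-1) ^ p.2.card * Fp k s w p := by
  rw [← Finset.sum_filter_add_sum_filter_not (TT k r) (fun p => IsKConnectedSet k (p.1 ∪ p.2))]
  convert add_zero _
  have hT : ∀ p ∈ (TT k r).filter (fun p => ¬ IsKConnectedSet k (p.1 ∪ p.2)),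
      p.1 ∪ p.2 ≠ Finset.univ := fun p hp =>
    PP_proper k r hrk p (Finset.mem_filter.1 (Finset.mem_filter.1 hp).1).1
  rw [toggle_sum k (by omega) s w _ (cgap k) (fun p => (-1) ^ p.2.card) hT]
  · refine Finset.sum_eq_zero fun p hp => ?_
    have hp := (Finset.mem_filter.1 hp).2
    dsimp only
    rw [Finset.card_insert_of_notMem hp.2]
    ring
  · intro p hp
    have := cgap_spec k _ (hT p hp) (Finset.mem_filter.1 hp).2
    exact ⟨this.1, this.2.1⟩
  · intro p hp h1 h2
    have := (cgap_spec k _ (hT p hp) (Finset.mem_filter.1 hp).2).2.2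
    simp only [TT, PP, Finset.mem_filter, Finset.mem_univ, true_and] at hp ⊢
    rw [card_t1 _ _ _ h1 h2, un_t1 _ _ _ h1, Finset.mem_erase, Finset.mem_insert]
    exact ⟨⟨hp.1.1, ⟨this.symm, hp.1.2.1⟩, fun h => h.elim (fun h => this h.symm) hp.1.2.2⟩, hp.2⟩
  · intro p hp h1 h2
    have := (cgap_spec k _ (hT p hp) (Finset.mem_filter.1 hp).2).2.2
    simp only [TT, PP, Finset.mem_filter, Finset.mem_univ, true_and] at hp ⊢
    rw [add_comm, card_t1 _ _ _ h2 h1, un_t2 _ _ _ h2, Finset.mem_erase, Finset.mem_insert]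
    exact ⟨⟨by omega, Or.inr hp.1.2.1, fun h => hp.1.2.2 h.2⟩, hp.2⟩

lemma asc_aux (ds as : List ℕ) (v : ℕ) (h1 : List.IsChain (· > ·) (ds ++ [v]))
    (h2 : List.IsChain (· < ·) (v :: as)) :
    ((ds ++ v :: as).zip (ds ++ v :: as).tail).countP (fun p => decide (p.1 < p.2)) = as.length := by
  induction ds with
  | nil =>
    simp only [List.nil_append, List.tail_cons]
    clear h1
    induction as generalizing v with
    | nil => simp
    | cons a as ih =>
      rw [List.isChain_cons_cons] at h2
      rw [List.zip_cons_cons, List.countP_cons, ih a h2.2]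
      simp [h2.1]
  | cons d ds ih =>
    cases ds with
    | nil =>
      simp only [List.cons_append, List.nil_append, List.isChain_cons_cons] at h1 ih ⊢
      have := ih (by simp)
      simp only [List.tail_cons] at this ⊢
      rw [List.zip_cons_cons, List.countP_cons, this]
      simp; omega
    | cons e ds =>
      simp only [List.cons_append, List.isChain_cons_cons] at h1 ih ⊢
      have := ih h1.2
      simp only [List.tail_cons] at this ⊢
      rw [List.zip_cons_cons, List.countP_cons, this]
      simp; omega

def WW (k : ℕ) (p : Finset (Idx k) × Finset (Idx k)) : Word k :=
  decW k (gap k (p.1 ∪ p.2)) p.1 ++ incW k (gap k (p.1 ∪ p.2)) p.2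

lemma WW_supp (k : ℕ) (p : Finset (Idx k) × Finset (Idx k)) : supp k (WW k p) = p.1 ∪ p.2 := by
  ext x
  simp [supp, WW, mem_decW, mem_incW]

lemma WW_length (k : ℕ) (p : Finset (Idx k) × Finset (Idx k)) :
    (WW k p).length = p.1.card + p.2.card := by
  simp [WW, decW_length, incW_length]

lemma WW_spec (k r : ℕ) (hr1 : 1 ≤ r) (hrk : r ≤ k) (p) (hp : p ∈ TT k r) :
    IsHookV k (WW k p) ∧ asc k (WW k p) = p.2.card := by
  obtain ⟨hpp, hm1, hm2⟩ := Finset.mem_filter.1 hp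
  have hu := PP_proper k r hrk p hpp
  have hmin := (mbot_spec k _ hu (PP_nonempty k r hr1 p hpp)).2.2
  rw [pos_eq] at hmin
  have hne : decW k (gap k (p.1 ∪ p.2)) p.1 ≠ [] := by
    intro h
    have := (mem_decW k (gap k (p.1 ∪ p.2)) p.1 _).2 hm1
    rw [h] at this
    simp at this
  have hch := decW_chain k (gap k (p.1 ∪ p.2)) p.1
  obtain ⟨l, v, hl⟩ := List.eq_nil_or_concat _ |>.resolve_left hne
  rw [List.concat_eq_append] at hl
  have hv : v = mbot k (p.1 ∪ p.2) := by
    have h1 := (mem_decW k (gap k (p.1 ∪ p.2)) p.1 _).2 hm1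
    rw [hl, List.mem_append] at h1
    rw [hl] at hch
    rcases h1 with h1 | h1
    · have h2 := (List.pairwise_append.1 hch).2.2 _ h1 v (by simp)
      have h3 : v ∈ p.1 := (mem_decW k (gap k (p.1 ∪ p.2)) p.1 _).1 (by rw [hl]; simp)
      have h4 := hmin v (Finset.mem_union_left _ h3)
      omega
    · exact (List.mem_singleton.1 h1).symm
  have hpl : posList k (WW k p) = l.map (posg k (gap k (p.1 ∪ p.2))) ++
      posg k (gap k (p.1 ∪ p.2)) v :: (incW k (gap k (p.1 ∪ p.2)) p.2).map
        (posg k (gap k (p.1 ∪ p.2))) := by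
    rw [posList, WW_supp, pos_eq, WW, hl]
    simp
  have hc1 : List.IsChain (· > ·) (l.map (posg k (gap k (p.1 ∪ p.2))) ++
      [posg k (gap k (p.1 ∪ p.2)) v]) := by
    rw [hl] at hch
    have := List.pairwise_map.2 hch
    rw [List.map_append] at this
    exact List.Pairwise.isChain this
  have hc2 : List.IsChain (· < ·) (posg k (gap k (p.1 ∪ p.2)) v ::
      (incW k (gap k (p.1 ∪ p.2)) p.2).map (posg k (gap k (p.1 ∪ p.2)))) := by
    refine List.Pairwise.isChain ?_
    rw [← List.map_cons, List.pairwise_map, List.pairwise_cons]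
    refine ⟨fun b hb => ?_, incW_chain k _ p.2⟩
    rw [mem_incW] at hb
    rw [hv]
    refine lt_of_le_of_ne (hmin b (Finset.mem_union_right _ hb)) fun e => hm2 ?_
    rwa [posg_inj k _ e]
  refine ⟨⟨by rwa [WW_supp], _, _, _, hpl, hc1, hc2⟩, ?_⟩
  rw [asc, hpl, asc_aux _ _ _ hc1 hc2, List.length_map, incW_length]

lemma WW_val {R : Type*} [CommRing R] (k r : ℕ) (hrk : r ≤ k) (s : AffS k → R)
    (w : AffS k) (p) (hp : p ∈ PP k r) : Fp k s w p = fval k s (WW k p) w := by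
  have hg := gap_not_mem k _ (PP_proper k r hrk p hp)
  refine fval_congr k s _ _ w ?_ ?_
  · rw [WW, sword_append, sword_append,
      sword_dword k p.1 _ fun h => hg (Finset.mem_union_left _ h),
      sword_iword k p.2 _ fun h => hg (Finset.mem_union_right _ h)]
  · rw [WW_length, List.length_append, dword_length, iword_length]

lemma WW_inj (k r : ℕ) (hr1 : 1 ≤ r) (hrk : r ≤ k) (p q) (hp : p ∈ TT k r) (hq : q ∈ TT k r)
    (h : WW k p = WW k q) : p = q := by
  have hS : p.1 ∪ p.2 = q.1 ∪ q.2 := by rw [← WW_supp, h, WW_supp]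
  have hc : p.2.card = q.2.card := by
    rw [← (WW_spec k r hr1 hrk p hp).2, h, (WW_spec k r hr1 hrk q hq).2]
  rw [WW, WW, hS] at h
  have h2 := List.append_inj' h (by rw [incW_length, incW_length, hc])
  refine Prod.ext (Finset.ext fun x => ?_) (Finset.ext fun x => ?_)
  · rw [← mem_decW k (gap k (q.1 ∪ q.2)), h2.1, mem_decW]
  · rw [← mem_incW k (gap k (q.1 ∪ q.2)), h2.2, mem_incW]

lemma WW_surj (k r : ℕ) (hr1 : 1 ≤ r) (hrk : r ≤ k) (u : Word k) (hu : IsHookV k u)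
    (hl : u.length = r) : ∃ p ∈ TT k r, WW k p = u := by
  obtain ⟨hsu, ds, as, v, hpl, hc1, hc2⟩ := hu
  have hpl' : u.map (posg k (gap k (supp k u))) = (ds ++ [v]) ++ as := by
    rw [← pos_eq, ← posList, hpl]; simp
  obtain ⟨u1, u2, rfl, h1, h2⟩ := List.map_eq_append_iff.1 hpl'
  have hS : supp k (u1 ++ u2) = u1.toFinset ∪ u2.toFinset := by simp [supp]
  rw [hS] at h1 h2 hsu
  have p1 : u1.Pairwise fun a b => posg k (gap k (u1.toFinset ∪ u2.toFinset)) a >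
      posg k (gap k (u1.toFinset ∪ u2.toFinset)) b := by
    rw [← List.pairwise_map (R := (· > ·)), h1]
    exact List.IsChain.pairwise hc1
  have p2' : (v :: as).Pairwise (· < ·) := List.IsChain.pairwise hc2
  have p2 : u2.Pairwise fun a b => posg k (gap k (u1.toFinset ∪ u2.toFinset)) a <
      posg k (gap k (u1.toFinset ∪ u2.toFinset)) b := by
    rw [← List.pairwise_map (R := (· < ·)), h2]
    exact (List.pairwise_cons.1 p2').2
  have e1 : u1 = decW k (gap k (u1.toFinset ∪ u2.toFinset)) u1.toFinset := by
    rw [dec_inc, ← incW_unique k _ u1.toFinset u1.reverse (List.pairwise_reverse.2 p1) (by simp),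
      List.reverse_reverse]
  have e2 : u2 = incW k (gap k (u1.toFinset ∪ u2.toFinset)) u2.toFinset :=
    incW_unique k _ _ _ p2 (by simp)
  have hpp : (u1.toFinset, u2.toFinset) ∈ PP k r := by
    simp only [PP, Finset.mem_filter, Finset.mem_univ, true_and]
    rw [← decW_length k (gap k (u1.toFinset ∪ u2.toFinset)) u1.toFinset, ← e1,
      ← incW_length k (gap k (u1.toFinset ∪ u2.toFinset)) u2.toFinset, ← e2, ← hl,
      List.length_append]
  refine ⟨(u1.toFinset, u2.toFinset), Finset.mem_filter.2 ⟨hpp, ?_⟩, ?_⟩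
  · have hmin := (mbot_spec k _ hsu (PP_nonempty k r hr1 _ hpp))
    obtain ⟨x, hx, hxv⟩ : ∃ x ∈ u1, posg k (gap k (u1.toFinset ∪ u2.toFinset)) x = v := by
      have : v ∈ u1.map (posg k (gap k (u1.toFinset ∪ u2.toFinset))) := by rw [h1]; simp
      simpa using this
    have hb : ∀ b ∈ u2, v < posg k (gap k (u1.toFinset ∪ u2.toFinset)) b := fun b hb =>
      (List.pairwise_cons.1 p2').1 _ (by rw [← h2]; exact List.mem_map_of_mem hb)
    have ha : ∀ a ∈ u1, v ≤ posg k (gap k (u1.toFinset ∪ u2.toFinset)) a := by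
      intro a ha
      have h3 : posg k (gap k (u1.toFinset ∪ u2.toFinset)) a ∈ ds ++ [v] := by
        rw [← h1]; exact List.mem_map_of_mem ha
      rcases List.mem_append.1 h3 with h | h
      · exact ((List.pairwise_append.1 (List.IsChain.pairwise hc1)).2.2 _ h v (by simp)).le
      · simp at h; omega
    have hx2 := hmin.2.2 x (by simp [hx])
    rw [pos_eq, hxv] at hx2
    have hm : mbot k (u1.toFinset ∪ u2.toFinset) ∉ u2 := fun h => by
      have := hb _ h; omega
    refine ⟨?_, by simpa using hm⟩
    have := hmin.1
    simp only [Finset.mem_union, List.mem_toFinset] at this ⊢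
    tauto
  · rw [WW, ← e1, ← e2]

lemma Vfin (k r : ℕ) : {u : Word k | IsHookV k u ∧ u.length = r ∧ IsKConnected k u}.Finite :=
  (List.finite_length_eq (Idx k) r).subset fun u hu => hu.2.1

def VV (k r : ℕ) : Finset (Word k) := (Vfin k r).toFinset

lemma mem_VV (k r : ℕ) (u : Word k) :
    u ∈ VV k r ↔ IsHookV k u ∧ u.length = r ∧ IsKConnected k u := by simp [VV]

lemma step3 {R : Type*} [CommRing R] (k r : ℕ) (hr1 : 1 ≤ r) (hrk : r ≤ k) (s : AffS k → R)
    (w : AffS k) :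
    ∑ p ∈ (TT k r).filter (fun p => IsKConnectedSet k (p.1 ∪ p.2)),
        (-1) ^ p.2.card * Fp k s w p = ∑ u ∈ VV k r, (-1) ^ asc k u * fval k s u w := by
  refine Finset.sum_bij (fun p _ => WW k p) ?_ ?_ ?_ ?_
  · intro p hp
    rw [Finset.mem_filter] at hp
    rw [mem_VV, WW_length, IsKConnected, WW_supp]
    exact ⟨(WW_spec k r hr1 hrk p hp.1).1,
      (Finset.mem_filter.1 (Finset.mem_filter.1 hp.1).1).2, hp.2⟩
  · intro p hp q hq h
    exact WW_inj k r hr1 hrk p q (Finset.mem_filter.1 hp).1 (Finset.mem_filter.1 hq).1 h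
  · intro u hu
    rw [mem_VV] at hu
    obtain ⟨p, hp, rfl⟩ := WW_surj k r hr1 hrk u hu.1 hu.2.1
    refine ⟨p, Finset.mem_filter.2 ⟨hp, ?_⟩, rfl⟩
    rw [← WW_supp]; exact hu.2.2
  · intro p hp
    rw [Finset.mem_filter] at hp
    rw [(WW_spec k r hr1 hrk p hp.1).2, WW_val k r hrk s w p (Finset.mem_filter.1 hp.1).1]

lemma asc_lt (k r : ℕ) (hr1 : 1 ≤ r) (hrk : r ≤ k) (u : Word k) (hu : u ∈ VV k r) :
    asc k u < r := by
  rw [mem_VV] at hu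
  obtain ⟨p, hp, rfl⟩ := WW_surj k r hr1 hrk u hu.1 hu.2.1
  rw [(WW_spec k r hr1 hrk p hp).2]
  have h := Finset.mem_filter.1 hp
  have h1 := (Finset.mem_filter.1 h.1).2
  have := Finset.card_pos.2 ⟨_, h.2.1⟩
  omega

lemma kcoeff_eq (k r : ℕ) (hr1 : 1 ≤ r) (hrk : r ≤ k) (P : Word k → Prop) :
    kcoeff k r P = ∑ u ∈ (VV k r).filter P, (-1 : ℤ) ^ asc k u := by
  rw [kcoeff, ← Finset.sum_fiberwise_of_maps_to (s := (VV k r).filter P) (t := Finset.range r)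
    (g := asc k) (fun u hu => Finset.mem_range.2
      (asc_lt k r hr1 hrk u (Finset.mem_filter.1 hu).1))]
  refine Finset.sum_congr rfl fun i _ => ?_
  rw [Finset.sum_congr rfl (g := fun _ => (-1 : ℤ) ^ i)
    (fun u hu => by rw [(Finset.mem_filter.1 hu).2]), Finset.sum_const]
  have : {u | u ∈ VSetC k r (i : ℤ) ∧ P u} =
      (((VV k r).filter P).filter fun u => asc k u = i : Finset (Word k)) := by
    ext u
    simp only [VSetC, VSet, Set.mem_setOf_eq, Finset.coe_filter, Finset.mem_filter, mem_VV,
      Nat.cast_inj]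
    tauto
  rw [this, Set.ncard_coe_finset, nsmul_eq_mul, mul_comm]

lemma rhs_eq {R : Type*} [CommRing R] (k r : ℕ) (hr1 : 1 ≤ r) (hrk : r ≤ k) (s : AffS k → R)
    (w : AffS k) :
    ∑ᶠ w' ∈ {w' : AffS k | IsGrassmannian k w'},
        kcoeff k r (fun u => dotW k u (some w) = some w') • s w' =
      ∑ u ∈ VV k r, (-1) ^ asc k u * fval k s u w := by
  have key : ∀ u, dotW k u (some w) = none ∨ dotW k u (some w) = some (sword k u * w) := by
    intro u; rw [dotW_eq]; split_ifs <;> simp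
  have h1 : ∀ w' : AffS k, (∑ᶠ (_ : w' ∈ {w' : AffS k | IsGrassmannian k w'}),
      kcoeff k r (fun u => dotW k u (some w) = some w') • s w') =
      ∑ u ∈ VV k r, if dotW k u (some w) = some w' then
        (if IsGrassmannian k w' then (-1) ^ asc k u * s w' else 0) else 0 := by
    intro w'
    rw [finsum_eq_if]
    by_cases hg : IsGrassmannian k w'
    · simp only [Set.mem_setOf_eq, hg, if_true]
      rw [kcoeff_eq k r hr1 hrk, Finset.sum_smul, Finset.sum_filter]
      refine Finset.sum_congr rfl fun u _ => ?_
      split_ifs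
      · rw [zsmul_eq_mul]; push_cast; rfl
      · rfl
    · simp [hg]
  simp only [h1]
  rw [finsum_eq_sum_of_support_subset (s := (VV k r).image fun u => sword k u * w)]
  · rw [Finset.sum_comm]
    refine Finset.sum_congr rfl fun u hu => ?_
    rw [fval]
    rcases key u with h | h
    · rw [h]; simp
    · rw [h, Finset.sum_eq_single (sword k u * w)]
      · simp
      · intro b _ hb
        rw [if_neg]
        simpa using hb.symm
      · intro hn
        exact absurd (Finset.mem_image_of_mem _ hu) hn
  · intro w' hw'
    rw [Function.mem_support] at hw'
    obtain ⟨u, hu, hne⟩ := Finset.exists_ne_zero_of_sum_ne_zero hw'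
    have : dotW k u (some w) = some w' := by
      by_contra hc; simp [hc] at hne
    rcases key u with h | h
    · rw [h] at this; simp at this
    · rw [h] at this
      simp only [Option.some.injEq] at this
      rw [← this]
      exact Finset.mem_coe.2 (Finset.mem_image_of_mem _ hu)

lemma tri_sum {R : Type*} [CommRing R] (G : ℕ → R) (r : ℕ) :
    ∑ i ∈ Finset.range r, ∑ b ∈ Finset.range (i + 1), G b =
      ∑ b ∈ Finset.range r, ((r - b : ℕ) : R) * G b := by
  induction r with
  | zero => simp
  | succ r ih =>
    rw [Finset.sum_range_succ, ih, Finset.sum_range_succ _ r, Finset.sum_range_succ _ r,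
      ← add_assoc, ← Finset.sum_add_distrib]
    congr 1
    · refine Finset.sum_congr rfl fun b hb => ?_
      have : r + 1 - b = (r - b) + 1 := by have := Finset.mem_range.1 hb; omega
      rw [this]; push_cast; ring
    · simp

lemma pR_eq {R : Type*} [CommRing R] (h e : ℕ → R) (r : ℕ) :
    pR h e r = ∑ b ∈ Finset.range r, ((r - b : ℕ) : R) * ((-1) ^ b * (h (r - b) * e b)) := by
  rw [← tri_sum, pR]
  refine Finset.sum_congr rfl fun i hi => ?_
  rw [← Finset.sum_range_reflect]
  refine Finset.sum_congr rfl fun j hj => ?_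
  have hi := Finset.mem_range.1 hi
  have hj := Finset.mem_range.1 hj
  have e1 : r - i + (i + 1 - 1 - j) = r - j := by omega
  have e2 : i - (i + 1 - 1 - j) = j := by omega
  have e3 : i + (i + 1 - 1 - j) = j + 2 * (i - j) := by omega
  rw [e1, e2, e3, pow_add, pow_mul, zsmul_eq_mul]
  push_cast
  simp

lemma lhs_eq {R : Type*} [CommRing R] (k : ℕ)
    (hR eR : ℕ → R)
    (s : AffS k → R)
    (hPieriH : ∀ w : AffS k, IsGrassmannian k w → ∀ r : ℕ, r ≤ k →
      hR r * s w = ∑ A ∈ Finset.powersetCard r (Finset.univ : Finset (Idx k)),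
        (dotW k (dwordOf k A) (some w)).elim 0 fun w' =>
          if IsGrassmannian k w' then s w' else 0)
    (hPieriE : ∀ w : AffS k, IsGrassmannian k w → ∀ r : ℕ, r ≤ k →
      eR r * s w = ∑ B ∈ Finset.powersetCard r (Finset.univ : Finset (Idx k)),
        (dotW k (iwordOf k B) (some w)).elim 0 fun w' =>
          if IsGrassmannian k w' then s w' else 0)
    (r : ℕ) (hrk : r ≤ k) (w : AffS k) (hw : IsGrassmannian k w) :
    pR hR eR r * s w = ∑ p ∈ PP k r, ((-1) ^ p.2.card * (p.1.card : R)) * Fp k s w p := by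
  have hhe : ∀ a b, a ≤ k → b ≤ k → hR a * eR b * s w =
      ∑ p ∈ Finset.powersetCard a (Finset.univ : Finset (Idx k)) ×ˢ
        Finset.powersetCard b (Finset.univ : Finset (Idx k)), Fp k s w p := by
    intro a b ha hb
    rw [mul_assoc, hPieriE w hw b hb, Finset.mul_sum, Finset.sum_product_right]
    refine Finset.sum_congr rfl fun B _ => ?_
    simp only [Fp, fval, dotW_append]
    cases hB : dotW k (iwordOf k B) (some w) with
    | none => simp [dotW_none]
    | some w1 =>
      simp only [Option.elim_some]
      split_ifs with hg
      · exact hPieriH w1 hg a ha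
      · rw [mul_zero]
        symm
        refine Finset.sum_eq_zero fun A _ => ?_
        cases hA : dotW k (dwordOf k A) (some w1) with
        | none => rfl
        | some w2 =>
          simp only [Option.elim_some]
          rw [if_neg]
          exact fun h => hg (grass_of_dot k _ _ _ hA h)
  have hmaps : ∀ p ∈ PP k r, p.2.card ∈ Finset.range (r + 1) := fun p hp => by
    have := (Finset.mem_filter.1 hp).2
    rw [Finset.mem_range]; omega
  rw [← Finset.sum_fiberwise_of_maps_to hmaps, Finset.sum_range_succ, pR_eq, Finset.sum_mul]
  have hlast : ∑ p ∈ PP k r with p.2.card = r, ((-1) ^ p.2.card * (p.1.card : R)) * Fp k s w p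
      = 0 := by
    refine Finset.sum_eq_zero fun p hp => ?_
    simp only [PP, Finset.mem_filter, Finset.mem_univ, true_and] at hp
    have : p.1.card = 0 := by omega
    rw [this]; simp
  rw [hlast, add_zero]
  refine Finset.sum_congr rfl fun b hb => ?_
  have hb := Finset.mem_range.1 hb
  have e1 : ((r - b : ℕ) : R) * ((-1) ^ b * (hR (r - b) * eR b)) * s w =
    ((-1) ^ b * ((r - b : ℕ) : R)) * (hR (r - b) * eR b * s w) := by ring
  rw [e1, hhe _ _ (by omega) (by omega), Finset.mul_sum]
  refine Finset.sum_congr ?_ ?_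
  · ext p
    simp only [PP, Finset.mem_filter, Finset.mem_univ, true_and, Finset.mem_product,
      Finset.mem_powersetCard, Finset.subset_univ]
    omega
  · intro p hp
    simp only [PP, Finset.mem_filter, Finset.mem_univ, true_and] at hp
    have : p.1.card = r - b := by omega
    rw [this, hp.2]

theorem statement10 (k : ℕ) (hk : 1 ≤ k)
    (R : Type*) [CommRing R]
    (hR eR : ℕ → R) (hR0 : hR 0 = 1) (eR0 : eR 0 = 1)
    (s : AffS k → R) (hs1 : s 1 = 1)
    (hPieriH : ∀ w : AffS k, IsGrassmannian k w → ∀ r : ℕ, r ≤ k →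
      hR r * s w = ∑ A ∈ Finset.powersetCard r (Finset.univ : Finset (Idx k)),
        (dotW k (dwordOf k A) (some w)).elim 0 fun w' =>
          if IsGrassmannian k w' then s w' else 0)
    (hPieriE : ∀ w : AffS k, IsGrassmannian k w → ∀ r : ℕ, r ≤ k →
      eR r * s w = ∑ B ∈ Finset.powersetCard r (Finset.univ : Finset (Idx k)),
        (dotW k (iwordOf k B) (some w)).elim 0 fun w' =>
          if IsGrassmannian k w' then s w' else 0)
    (r : ℕ) (hr1 : 1 ≤ r) (hrk : r ≤ k) (w : AffS k) (hw : IsGrassmannian k w) :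
    pR hR eR r * s w =
      ∑ᶠ w' ∈ {w' : AffS k | IsGrassmannian k w'},
        kcoeff k r (fun u => dotW k u (some w) = some w') • s w' := by
  rw [lhs_eq k hR eR s hPieriH hPieriE r hrk w hw, step1 k r hr1 hrk, step2 k r hr1 hrk,
    step3 k r hr1 hrk, rhs_eq k r hr1 hrk]

end MN

end
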